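/- arXiv:2112.09227 — 2 statements merged into one kernel-verified Lean document; each statement's English description precedes it below -/
import Mathlib

section
/- For any bipartite density operator ρ_{AB} on finite-dimensional H_A ⊗ H_B, the conditional von Neumann entropy satisfies |H(A|B)_ρ| ≤ H(A)_ρ, where H(A|B)_ρ = H(ρ_{AB}) - H(ρ_B) and H denotes von Neumann entropy. -/
open Matrix BigOperators
open scoped ComplexOrder

noncomputable section

/-- A density operator: positive semidefinite with unit trace. -/
def IsDensity {n : Type*} [Fintype n] [DecidableEq n] (ρ : Matrix n n ℂ) : Prop :=
  ρ.PosSemidef ∧ ρ.trace = 1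

/-- Von Neumann entropy (in bits) of a matrix: `-Tr(ρ log ρ)` computed via the
eigenvalues when the matrix is Hermitian, junk value `0` otherwise. -/
def vNE {n : Type*} [Fintype n] [DecidableEq n] (ρ : Matrix n n ℂ) : ℝ :=
  if h : ρ.IsHermitian then (∑ i, Real.negMulLog (h.eigenvalues i)) / Real.log 2 else 0

/-- Partial trace over the second (B) factor: `ρ_A = Tr_B ρ_{AB}`. -/
def ptraceB {a b : Type*} [Fintype a] [Fintype b]
    (ρ : Matrix (a × b) (a × b) ℂ) : Matrix a a ℂ :=
  fun i j => ∑ k, ρ (i, k) (j, k)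

/-- Partial trace over the first (A) factor: `ρ_B = Tr_A ρ_{AB}`. -/
def ptraceA {a b : Type*} [Fintype a] [Fintype b]
    (ρ : Matrix (a × b) (a × b) ℂ) : Matrix b b ℂ :=
  fun i j => ∑ k, ρ (k, i) (k, j)

open scoped Kronecker MatrixOrder

/-- The gap in subadditivity of Shannon entropy, termwise: `log x ≤ x - 1` at `x = s * t / p`. -/
lemma negMulLog_le_of_le {p s t : ℝ} (hp : 0 ≤ p) (hs : p ≤ s) (ht : p ≤ t) :
    Real.negMulLog p ≤ -(p * Real.log s) - p * Real.log t + s * t - p := by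
  rcases hp.eq_or_lt with rfl | hp
  · simpa using mul_nonneg hs ht
  · have hs' := hp.trans_le hs
    have ht' := hp.trans_le ht
    have h := Real.log_le_sub_one_of_pos (div_pos (mul_pos hs' ht') hp)
    rw [Real.log_div (mul_pos hs' ht').ne' hp.ne', Real.log_mul hs'.ne' ht'.ne'] at h
    have h' := mul_le_mul_of_nonneg_left h hp.le
    have hq : p * (s * t / p - 1) = s * t - p := by field_simp
    rw [hq] at h'
    rw [Real.negMulLog]
    linarith

/-- Subadditivity of Shannon entropy. -/
lemma sum_negMulLog_le_add_marginals {a b : Type*} [Fintype a] [Fintype b] (p : a × b → ℝ)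
    (hp : ∀ x, 0 ≤ p x) (hp1 : ∑ x, p x = 1) :
    ∑ x, Real.negMulLog (p x) ≤
      ∑ i, Real.negMulLog (∑ k, p (i, k)) + ∑ k, Real.negMulLog (∑ i, p (i, k)) := by
  set s : a → ℝ := fun i => ∑ k, p (i, k)
  set t : b → ℝ := fun k => ∑ i, p (i, k)
  have hs1 : ∑ i, s i = 1 := by rw [← hp1, Fintype.sum_prod_type]
  have ht1 : ∑ k, t k = 1 := by rw [← hp1, Fintype.sum_prod_type_right]
  have hterm : ∀ x : a × b, Real.negMulLog (p x) ≤
      -(p x * Real.log (s x.1)) - p x * Real.log (t x.2) + s x.1 * t x.2 - p x := fun x =>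
    negMulLog_le_of_le (hp x)
      (Finset.single_le_sum (f := fun k => p (x.1, k)) (fun k _ => hp _) (Finset.mem_univ x.2))
      (Finset.single_le_sum (f := fun i => p (i, x.2)) (fun i _ => hp _) (Finset.mem_univ x.1))
  refine (Finset.sum_le_sum fun x _ => hterm x).trans_eq ?_
  have h1 : ∑ x : a × b, p x * Real.log (s x.1) = -∑ i, Real.negMulLog (s i) := by
    simp only [Fintype.sum_prod_type, ← Finset.sum_mul, Real.negMulLog, neg_mul,
      Finset.sum_neg_distrib, neg_neg, s]
  have h2 : ∑ x : a × b, p x * Real.log (t x.2) = -∑ k, Real.negMulLog (t k) := by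
    simp only [Fintype.sum_prod_type_right, ← Finset.sum_mul, Real.negMulLog, neg_mul,
      Finset.sum_neg_distrib, neg_neg, t]
  have h3 : ∑ x : a × b, s x.1 * t x.2 = 1 := by
    rw [Fintype.sum_prod_type, ← Finset.sum_mul_sum, hs1, ht1, one_mul]
  rw [Finset.sum_sub_distrib, Finset.sum_add_distrib, Finset.sum_sub_distrib,
    Finset.sum_neg_distrib, h1, h2, h3, hp1]
  ring

section PartialTrace

variable {a b : Type*} [Fintype a] [Fintype b]

lemma trace_ptraceB (ρ : Matrix (a × b) (a × b) ℂ) : (ptraceB ρ).trace = ρ.trace := by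
  simp [Matrix.trace, ptraceB, Fintype.sum_prod_type]

lemma isHermitian_ptraceB {ρ : Matrix (a × b) (a × b) ℂ} (h : ρ.IsHermitian) :
    (ptraceB ρ).IsHermitian := by
  ext i j
  simp [ptraceB, h.apply]

lemma isHermitian_ptraceA {ρ : Matrix (a × b) (a × b) ℂ} (h : ρ.IsHermitian) :
    (ptraceA ρ).IsHermitian := by
  ext i j
  simp [ptraceA, h.apply]

lemma ptraceA_eq_ptraceB_swap (ρ : Matrix (a × b) (a × b) ℂ) :
    ptraceA ρ = ptraceB (ρ.submatrix Prod.swap Prod.swap) := rfl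

lemma ptraceB_kronecker_mul_mul [DecidableEq b] (P R : Matrix a a ℂ) (Q S : Matrix b b ℂ)
    (ρ : Matrix (a × b) (a × b) ℂ) (h : S * Q = 1) :
    ptraceB ((P ⊗ₖ Q) * ρ * (R ⊗ₖ S)) = P * ptraceB ρ * R := by
  have hSQ : ∀ k' k, ∑ l, S k' l * Q l k = if k' = k then 1 else 0 := fun k' k => by
    rw [← Matrix.mul_apply, h, Matrix.one_apply]
  ext j j'
  calc ptraceB ((P ⊗ₖ Q) * ρ * (R ⊗ₖ S)) j j'
      = ∑ l, ∑ i', ∑ k', ∑ i, ∑ k,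
          P j i * ρ (i, k) (i', k') * R i' j' * (S k' l * Q l k) := by
        simp only [ptraceB, Matrix.mul_apply, Fintype.sum_prod_type, kronecker_apply,
          Finset.sum_mul]
        refine Finset.sum_congr rfl fun l _ => Finset.sum_congr rfl fun i' _ =>
          Finset.sum_congr rfl fun k' _ => Finset.sum_congr rfl fun i _ =>
          Finset.sum_congr rfl fun k _ => by ring
    _ = ∑ i', ∑ k', ∑ i, ∑ k, ∑ l,
          P j i * ρ (i, k) (i', k') * R i' j' * (S k' l * Q l k) := by
        rw [Finset.sum_comm]
        refine Finset.sum_congr rfl fun i' _ => ?_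
        rw [Finset.sum_comm]
        refine Finset.sum_congr rfl fun k' _ => ?_
        rw [Finset.sum_comm]
        exact Finset.sum_congr rfl fun i _ => Finset.sum_comm
    _ = ∑ i', ∑ k', ∑ i, P j i * ρ (i, k') (i', k') * R i' j' := by
        simp [← Finset.mul_sum, hSQ]
    _ = (P * ptraceB ρ * R) j j' := by
        simp only [ptraceB, Matrix.mul_apply, Finset.sum_mul, Finset.mul_sum]
        exact Finset.sum_congr rfl fun i' _ => Finset.sum_comm

lemma ptraceA_kronecker_mul_mul [DecidableEq a] (P R : Matrix a a ℂ) (Q S : Matrix b b ℂ)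
    (ρ : Matrix (a × b) (a × b) ℂ) (h : R * P = 1) :
    ptraceA ((P ⊗ₖ Q) * ρ * (R ⊗ₖ S)) = Q * ptraceA ρ * S := by
  have hswap : ∀ (P : Matrix a a ℂ) (Q : Matrix b b ℂ),
      (P ⊗ₖ Q).submatrix Prod.swap Prod.swap = Q ⊗ₖ P := fun P Q => by
    ext x y
    simp [mul_comm]
  rw [ptraceA_eq_ptraceB_swap, ptraceA_eq_ptraceB_swap,
    ← ptraceB_kronecker_mul_mul Q S P R _ h, ← hswap P Q, ← hswap R S]
  congr 1
  exact (submatrix_mul _ _ _ _ _ Prod.swap_bijective).trans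
    (congrArg (· * _) (submatrix_mul _ _ _ _ _ Prod.swap_bijective))

end PartialTrace

section Spectral

variable {n : Type*} [Fintype n] [DecidableEq n]

lemma conjTranspose_eigenvectorUnitary_mul_mul {A : Matrix n n ℂ} (h : A.IsHermitian) :
    (h.eigenvectorUnitary : Matrix n n ℂ)ᴴ * A * (h.eigenvectorUnitary : Matrix n n ℂ) =
      diagonal (fun i => (h.eigenvalues i : ℂ)) := by
  have := h.conjStarAlgAut_star_eigenvectorUnitary
  rw [Unitary.conjStarAlgAut_star_apply] at this
  exact this

/-- Passing to the diagonal in any orthonormal basis increases entropy. -/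
lemma sum_negMulLog_eigenvalues_le {A : Matrix n n ℂ} (hA : A.PosSemidef) {W : Matrix n n ℂ}
    (hW : W ∈ unitaryGroup n ℂ) :
    ∑ k, Real.negMulLog (hA.1.eigenvalues k) ≤ ∑ x, Real.negMulLog ((Wᴴ * A * W) x x).re := by
  set E : Matrix n n ℂ := hA.1.eigenvectorUnitary.1
  set ev := hA.1.eigenvalues
  set Q : Matrix n n ℂ := Wᴴ * E
  have hQ : Q ∈ unitaryGroup n ℂ := mul_mem (Unitary.star_mem hW) hA.1.eigenvectorUnitary.2
  have hspec : A = E * diagonal (fun i => (ev i : ℂ)) * Eᴴ := hA.1.spectral_theorem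
  have hD : Wᴴ * A * W = Q * diagonal (fun i => (ev i : ℂ)) * Qᴴ := by
    conv_lhs => rw [hspec]
    simp only [Q, conjTranspose_mul, conjTranspose_conjTranspose, Matrix.mul_assoc]
  have hdiag : ∀ x, ((Wᴴ * A * W) x x).re = ∑ k, Complex.normSq (Q x k) * ev k := fun x => by
    rw [hD, Matrix.mul_apply, Complex.re_sum]
    refine Finset.sum_congr rfl fun k _ => ?_
    rw [mul_diagonal, conjTranspose_apply, mul_right_comm, Complex.star_def, Complex.mul_conj,
      ← Complex.ofReal_mul, Complex.ofReal_re]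
  have hrow : ∀ x, ∑ k, Complex.normSq (Q x k) = 1 := fun x => by
    have h := congrFun (congrFun (mem_unitaryGroup_iff.1 hQ) x) x
    simp only [Matrix.mul_apply, star_apply, Complex.star_def, Complex.mul_conj, one_apply_eq] at h
    exact_mod_cast h
  have hcol : ∀ k, ∑ x, Complex.normSq (Q x k) = 1 := fun k => by
    have h := congrFun (congrFun (mem_unitaryGroup_iff'.1 hQ) k) k
    simp only [Matrix.mul_apply, star_apply, Complex.star_def, mul_comm (starRingEnd ℂ _),
      Complex.mul_conj, one_apply_eq] at h
    exact_mod_cast h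
  calc ∑ k, Real.negMulLog (ev k)
      = ∑ x, ∑ k, Complex.normSq (Q x k) * Real.negMulLog (ev k) := by
        rw [Finset.sum_comm]
        simp only [← Finset.sum_mul, hcol, one_mul]
    _ ≤ _ := Finset.sum_le_sum fun x _ => by
        rw [hdiag]
        exact Real.concaveOn_negMulLog.le_map_sum (fun k _ => Complex.normSq_nonneg _) (hrow x)
          (fun k _ => hA.eigenvalues_nonneg k)

lemma vNE_eq_of_isHermitian {A : Matrix n n ℂ} (h : A.IsHermitian) :
    vNE A = (∑ i, Real.negMulLog (h.eigenvalues i)) / Real.log 2 := dif_pos h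

lemma vNE_eq_sum_roots_charpoly {A : Matrix n n ℂ} (h : A.IsHermitian) :
    vNE A = (A.charpoly.roots.map fun z => Real.negMulLog z.re).sum / Real.log 2 := by
  rw [vNE_eq_of_isHermitian h, h.roots_charpoly_eq_eigenvalues, Multiset.map_map]
  rfl

lemma vNE_transpose {A : Matrix n n ℂ} (h : A.IsHermitian) : vNE Aᵀ = vNE A := by
  rw [vNE_eq_sum_roots_charpoly h, vNE_eq_sum_roots_charpoly h.transpose, charpoly_transpose]

/-- `A * Aᴴ` and `Aᴴ * A` have the same nonzero spectrum, hence the same entropy. -/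
lemma vNE_mul_conjTranspose {m : Type*} [Fintype m] [DecidableEq m] (A : Matrix m n ℂ) :
    vNE (A * Aᴴ) = vNE (Aᴴ * A) := by
  rw [vNE_eq_sum_roots_charpoly (isHermitian_mul_conjTranspose_self A),
    vNE_eq_sum_roots_charpoly (isHermitian_conjTranspose_mul_self A)]
  have h := congrArg (fun p => (p.roots.map fun z : ℂ => Real.negMulLog z.re).sum)
    (charpoly_mul_comm' A Aᴴ)
  rw [Polynomial.roots_mul (mul_ne_zero (pow_ne_zero _ Polynomial.X_ne_zero)
      (charpoly_monic _).ne_zero),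
    Polynomial.roots_mul (mul_ne_zero (pow_ne_zero _ Polynomial.X_ne_zero)
      (charpoly_monic _).ne_zero)] at h
  simp only [Polynomial.roots_X_pow, Multiset.map_add, Multiset.sum_add, Multiset.map_nsmul,
    Multiset.sum_nsmul, Multiset.map_singleton, Multiset.sum_singleton, Complex.zero_re,
    Real.negMulLog_zero, smul_zero, zero_add] at h
  rw [h]

end Spectral

/-- Subadditivity of von Neumann entropy. -/
lemma vNE_le_add_ptrace {a b : Type*} [Fintype a] [DecidableEq a] [Fintype b] [DecidableEq b]
    {ρ : Matrix (a × b) (a × b) ℂ} (hρ : IsDensity ρ) :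
    vNE ρ ≤ vNE (ptraceB ρ) + vNE (ptraceA ρ) := by
  have hA := isHermitian_ptraceB hρ.1.1
  have hB := isHermitian_ptraceA hρ.1.1
  rw [vNE_eq_of_isHermitian hρ.1.1, vNE_eq_of_isHermitian hA, vNE_eq_of_isHermitian hB, ← add_div]
  refine div_le_div_of_nonneg_right ?_ (Real.log_nonneg one_le_two)
  set U : Matrix a a ℂ := hA.eigenvectorUnitary.1
  set V : Matrix b b ℂ := hB.eigenvectorUnitary.1
  have hU : U ∈ unitaryGroup a ℂ := hA.eigenvectorUnitary.2
  have hV : V ∈ unitaryGroup b ℂ := hB.eigenvectorUnitary.2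
  have hW : U ⊗ₖ V ∈ unitaryGroup (a × b) ℂ := kronecker_mem_unitary hU hV
  have hdiagB : ptraceB ((U ⊗ₖ V)ᴴ * ρ * (U ⊗ₖ V)) =
      diagonal (fun i => (hA.eigenvalues i : ℂ)) := by
    rw [conjTranspose_kronecker, ptraceB_kronecker_mul_mul Uᴴ U Vᴴ V ρ (mem_unitaryGroup_iff.1 hV)]
    exact conjTranspose_eigenvectorUnitary_mul_mul hA
  have hdiagA : ptraceA ((U ⊗ₖ V)ᴴ * ρ * (U ⊗ₖ V)) =
      diagonal (fun i => (hB.eigenvalues i : ℂ)) := by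
    rw [conjTranspose_kronecker, ptraceA_kronecker_mul_mul Uᴴ U Vᴴ V ρ (mem_unitaryGroup_iff.1 hU)]
    exact conjTranspose_eigenvectorUnitary_mul_mul hB
  set D := (U ⊗ₖ V)ᴴ * ρ * (U ⊗ₖ V)
  have hD : D.PosSemidef := hρ.1.conjTranspose_mul_mul_same _
  have hDtr : D.trace = 1 := by
    rw [← hρ.2, trace_mul_cycle, ← star_eq_conjTranspose, mem_unitaryGroup_iff.1 hW,
      Matrix.one_mul]
  have hmA : ∀ i, ∑ k, (D (i, k) (i, k)).re = hA.eigenvalues i := fun i => by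
    have h := congrArg Complex.re (congrFun (congrFun hdiagB i) i)
    simpa [ptraceB] using h
  have hmB : ∀ k, ∑ i, (D (i, k) (i, k)).re = hB.eigenvalues k := fun k => by
    have h := congrArg Complex.re (congrFun (congrFun hdiagA k) k)
    simpa [ptraceA] using h
  refine (sum_negMulLog_eigenvalues_le hρ.1 hW).trans ?_
  have h := sum_negMulLog_le_add_marginals (fun x => (D x x).re)
    (fun x => (Complex.nonneg_iff.1 hD.diag_nonneg).1)
    (by simpa [Matrix.trace] using congrArg Complex.re hDtr)
  simpa only [hmA, hmB] using h

/-- The Araki–Lieb inequality, by purifying `ρ` and applying subadditivity to the complement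
of the system `B`. -/
lemma vNE_ptraceA_le {a b : Type*} [Fintype a] [DecidableEq a] [Fintype b] [DecidableEq b]
    {ρ : Matrix (a × b) (a × b) ℂ} (hρ : IsDensity ρ) :
    vNE (ptraceA ρ) ≤ vNE (ptraceB ρ) + vNE ρ := by
  obtain ⟨M, hM⟩ : ∃ M : Matrix (a × b) (a × b) ℂ, ρ = M * Mᴴ := by
    obtain ⟨M, hM⟩ := CStarAlgebra.nonneg_iff_eq_star_mul_self.1 hρ.1.nonneg
    exact ⟨Mᴴ, by rw [hM, conjTranspose_conjTranspose, star_eq_conjTranspose]⟩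
  let N : Matrix (a × (a × b)) b ℂ := of fun x k => M (x.1, k) x.2
  have hptB : ptraceB (N * Nᴴ) = ptraceB ρ := by
    ext i j
    simp only [ptraceB, hM, Matrix.mul_apply, conjTranspose_apply, of_apply, N]
    exact Finset.sum_comm
  have hptA : ptraceA (N * Nᴴ) = (Mᴴ * M)ᵀ := by
    ext r r'
    simp only [ptraceA, Matrix.mul_apply, conjTranspose_apply, transpose_apply, N, of_apply,
      Fintype.sum_prod_type]
    simp only [mul_comm]
  have hcompl : Nᴴ * N = (ptraceA ρ)ᵀ := by
    ext k k'
    simp only [ptraceA, hM, Matrix.mul_apply, conjTranspose_apply, transpose_apply, N, of_apply,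
      Fintype.sum_prod_type]
    simp only [mul_comm]
  have hdens : IsDensity (N * Nᴴ) :=
    ⟨posSemidef_self_mul_conjTranspose N, by rw [← trace_ptraceB, hptB, trace_ptraceB, hρ.2]⟩
  have h := vNE_le_add_ptrace hdens
  rwa [hptB, hptA, vNE_transpose (isHermitian_conjTranspose_mul_self M), ← vNE_mul_conjTranspose,
    ← hM, vNE_mul_conjTranspose, hcompl, vNE_transpose (isHermitian_ptraceA hρ.1.1)] at h

/-- For any bipartite density operator `ρ_{AB}`, the conditional von Neumann
entropy satisfies `|H(A|B)_ρ| ≤ H(A)_ρ`, where `H(A|B)_ρ = H(ρ_{AB}) - H(ρ_B)`. -/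
theorem abs_condEntropy_le {dA dB : ℕ}
    (ρ : Matrix (Fin dA × Fin dB) (Fin dA × Fin dB) ℂ) (hρ : IsDensity ρ) :
    |vNE ρ - vNE (ptraceA ρ)| ≤ vNE (ptraceB ρ) := by
  rw [abs_le]
  constructor
  · linarith [vNE_ptraceA_le hρ]
  · linarith [vNE_le_add_ptrace hρ]

end
end

section
/- Entanglement generation converse step: if ρ_{K M̂} is a density operator on H_K ⊗ H_{M̂} with dim H_K = dim H_M = 2^{nQ}, Φ_{KM} is the maximally entangled state, and (1/2)‖ρ_{K M̂} - Φ_{KM}‖₁ ≤ α, then the coherent information satisfies I(K⟩M̂)_ρ ≥ nQ - f(α, nQ), where I(K⟩B)_ρ = H(ρ_B) - H(ρ_{KB}) and f(α, t) = 2αt + (1+α)h₂(α/(1+α)) is the Alicki–Fannes–Winter bound (h₂ being binary entropy). -/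
open Matrix BigOperators
open scoped ComplexOrder

noncomputable section

/-- Trace norm `‖F‖₁ = Tr √(F†F)`. -/
def traceNorm {n : Type*} [Fintype n] [DecidableEq n] (A : Matrix n n ℂ) : ℝ :=
  ∑ i, Real.sqrt ((Matrix.posSemidef_conjTranspose_mul_self A).1.eigenvalues i)

/-- Coherent information `I(K⟩B)_ρ = H(ρ_B) - H(ρ_{KB})` of a bipartite state,
where `K` is the first factor. -/
def cohInfo {a b : Type*} [Fintype a] [Fintype b] [DecidableEq a] [DecidableEq b]
    (ρ : Matrix (a × b) (a × b) ℂ) : ℝ :=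
  vNE (ptraceA ρ) - vNE ρ

/-- The maximally entangled state `Φ_{KM}` of local dimension `d`. -/
def maxEntState (d : ℕ) : Matrix (Fin d × Fin d) (Fin d × Fin d) ℂ :=
  fun p q => if p.1 = p.2 ∧ q.1 = q.2 then (d : ℂ)⁻¹ else 0

/-- Binary entropy (in bits). -/
def binEnt (x : ℝ) : ℝ := (Real.negMulLog x + Real.negMulLog (1 - x)) / Real.log 2

/-- The primitive `s ↦ p log qₛ - qₛ`, with `qₛ = (1 - s) q + s p`, of `s ↦ (1 - s) (p - q)² / qₛ`;
its increment over `[0, 1]` is `p log p - p log q - p + q`. -/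
def segLog (p q s : ℝ) : ℝ := p * Real.log ((1 - s) * q + s * p) - ((1 - s) * q + s * p)

lemma hasDerivAt_segLog {p q s : ℝ} (hp : 0 ≤ p) (hq : 0 ≤ q) (hs0 : 0 < s) (hs1 : s < 1) :
    HasDerivAt (segLog p q) ((1 - s) * ((p - q) ^ 2 / ((1 - s) * q + s * p))) s := by
  have hlin : HasDerivAt (fun s : ℝ => (1 - s) * q + s * p) (p - q) s := by
    have h := (((hasDerivAt_id s).const_sub 1).mul_const q).add ((hasDerivAt_id s).mul_const p)
    refine h.congr_deriv ?_
    ring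
  have h1s : 0 < 1 - s := by linarith
  rcases eq_or_ne ((1 - s) * q + s * p) 0 with h0 | h0
  · have hp0 : p = 0 := by
      have := mul_nonneg h1s.le hq
      have := mul_nonneg hs0.le hp
      have : s * p = 0 := by linarith
      exact (mul_eq_zero.mp this).resolve_left hs0.ne'
    have hq0 : q = 0 := by
      rw [hp0, mul_zero, add_zero] at h0
      exact (mul_eq_zero.mp h0).resolve_left h1s.ne'
    subst hp0 hq0
    have : segLog 0 0 = fun _ => 0 := by
      funext x
      simp [segLog]
    rw [this]
    simpa using hasDerivAt_const s (0 : ℝ)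
  · have h := ((hlin.log h0).const_mul p).sub hlin
    refine h.congr_deriv ?_
    generalize hm : (1 - s) * q + s * p = m at h0
    have hm : m = p - (1 - s) * (p - q) := by rw [← hm]; ring
    field_simp
    rw [hm]
    ring

lemma continuousOn_segLog {p q : ℝ} (hp : 0 ≤ p) (hq : 0 ≤ q) (hsupp : q = 0 → p = 0) :
    ContinuousOn (segLog p q) (Set.Icc 0 1) := by
  rcases hp.eq_or_lt with rfl | hp
  · have : segLog 0 q = fun s => -((1 - s) * q) := by
      funext x
      simp [segLog]
    rw [this]
    fun_prop
  · have hq : 0 < q := lt_of_le_of_ne hq fun h => hp.ne' (hsupp h.symm)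
    unfold segLog
    refine ContinuousOn.sub (continuousOn_const.mul (ContinuousOn.log (by fun_prop) ?_))
      (by fun_prop)
    rintro s ⟨h0, h1⟩
    rcases h0.eq_or_lt with rfl | h0
    · simpa using hq.ne'
    · have := mul_pos h0 hp
      have := mul_nonneg (sub_nonneg.mpr h1) hq.le
      linarith

lemma segLog_one_sub_zero (p q : ℝ) :
    segLog p q 1 - segLog p q 0 = p * Real.log p - p * Real.log q - p + q := by
  simp only [segLog, sub_self, zero_mul, one_mul, zero_add, sub_zero, add_zero]
  ring

lemma two_mul_re_sub_le {m Δ : ℝ} (x y : ℂ) (hm : 0 ≤ m) (h : m = 0 → Δ = 0) :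
    2 * Δ * (x * star y).re - m * Complex.normSq x ≤ Complex.normSq y * (Δ ^ 2 / m) := by
  rcases hm.eq_or_lt with rfl | hm
  · simp [h rfl]
  · rw [← mul_div_assoc, le_div_iff₀ hm]
    simp only [Complex.normSq_apply, Complex.mul_re, Complex.star_def, Complex.conj_re,
      Complex.conj_im]
    nlinarith [sq_nonneg (Δ * y.re - m * x.re), sq_nonneg (Δ * y.im - m * x.im)]

lemma normSq_interp (x₁ x₀ : ℝ) (a y : ℂ) :
    Complex.normSq (x₁ * a + x₀ * (y - a)) = (x₁ ^ 2 + x₀ ^ 2 - 2 * x₁ * x₀) * Complex.normSq a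
      + (2 * x₁ * x₀ - 2 * x₀ ^ 2) * (a * star y).re + x₀ ^ 2 * Complex.normSq y := by
  simp [Complex.normSq_apply]
  ring

lemma re_interp (x₁ x₀ : ℝ) (a y : ℂ) :
    ((x₁ * a + x₀ * (y - a)) * star y).re
      = (x₁ - x₀) * (a * star y).re + x₀ * Complex.normSq y := by
  simp [Complex.normSq_apply]
  ring

lemma sq_div_add_sq_div_le_sum {I J : Type*} [Fintype I] [Fintype J] (y a : I → J → ℂ)
    (u : I → ℝ) (v : J → ℝ)
    (hy : ∀ i, ∑ j, Complex.normSq (y i j) = 1) (hy' : ∀ j, ∑ i, Complex.normSq (y i j) = 1)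
    (ha : ∀ i, ∑ j, Complex.normSq (a i j) = u i) (ha' : ∀ j, ∑ i, Complex.normSq (a i j) = v j)
    (hay : ∀ i, ∑ j, (a i j * star (y i j)).re = u i)
    (hay' : ∀ j, ∑ i, (a i j * star (y i j)).re = v j)
    {p : I → ℝ} {q : J → ℝ} (hp : ∀ i, 0 ≤ p i) (hq : ∀ j, 0 ≤ q j)
    {s : ℝ} (hs0 : 0 < s) (hs1 : s < 1) {r₁ r₀ c₁ c₀ : ℝ}
    (hr₁ : ∑ i, p i * u i = r₁) (hr₀ : ∑ i, p i * (1 - u i) = r₀)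
    (hc₁ : ∑ j, q j * v j = c₁) (hc₀ : ∑ j, q j * (1 - v j) = c₀) :
    (r₁ - c₁) ^ 2 / ((1 - s) * c₁ + s * r₁) + (r₀ - c₀) ^ 2 / ((1 - s) * c₀ + s * r₀)
      ≤ ∑ i, ∑ j, Complex.normSq (y i j) * ((p i - q j) ^ 2 / ((1 - s) * q j + s * p i)) := by
  have key (x₁ x₀ : ℝ) : 2 * (r₁ - c₁) * x₁ - ((1 - s) * c₁ + s * r₁) * x₁ ^ 2
      + (2 * (r₀ - c₀) * x₀ - ((1 - s) * c₀ + s * r₀) * x₀ ^ 2)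
      ≤ ∑ i, ∑ j, Complex.normSq (y i j) * ((p i - q j) ^ 2 / ((1 - s) * q j + s * p i)) := by
    let x : I → J → ℂ := fun i j => x₁ * a i j + x₀ * (y i j - a i j)
    have hx (i) : ∑ j, Complex.normSq (x i j) = x₁ ^ 2 * u i + x₀ ^ 2 * (1 - u i) := by
      simp only [x, normSq_interp, Finset.sum_add_distrib, ← Finset.mul_sum, hy, ha, hay]
      ring
    have hx' (j) : ∑ i, Complex.normSq (x i j) = x₁ ^ 2 * v j + x₀ ^ 2 * (1 - v j) := by
      simp only [x, normSq_interp, Finset.sum_add_distrib, ← Finset.mul_sum, hy', ha', hay']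
      ring
    have hxy (i) : ∑ j, (x i j * star (y i j)).re = x₁ * u i + x₀ * (1 - u i) := by
      simp only [x, re_interp, Finset.sum_add_distrib, ← Finset.mul_sum, hy, hay]
      ring
    have hxy' (j) : ∑ i, (x i j * star (y i j)).re = x₁ * v j + x₀ * (1 - v j) := by
      simp only [x, re_interp, Finset.sum_add_distrib, ← Finset.mul_sum, hy', hay']
      ring
    calc _ = ∑ i, p i * (2 * ∑ j, (x i j * star (y i j)).re - s * ∑ j, Complex.normSq (x i j))
          - ∑ j, q j * (2 * ∑ i, (x i j * star (y i j)).re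
            + (1 - s) * ∑ i, Complex.normSq (x i j)) := by
          simp only [hx, hx', hxy, hxy']
          have e₁ : ∑ i, p i * (2 * (x₁ * u i + x₀ * (1 - u i))
              - s * (x₁ ^ 2 * u i + x₀ ^ 2 * (1 - u i)))
              = (2 * x₁ - s * x₁ ^ 2) * r₁ + (2 * x₀ - s * x₀ ^ 2) * r₀ := by
            rw [← hr₁, ← hr₀, Finset.mul_sum, Finset.mul_sum, ← Finset.sum_add_distrib]
            exact Finset.sum_congr rfl fun i _ => by ring
          have e₂ : ∑ j, q j * (2 * (x₁ * v j + x₀ * (1 - v j))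
              + (1 - s) * (x₁ ^ 2 * v j + x₀ ^ 2 * (1 - v j)))
              = (2 * x₁ + (1 - s) * x₁ ^ 2) * c₁ + (2 * x₀ + (1 - s) * x₀ ^ 2) * c₀ := by
            rw [← hc₁, ← hc₀, Finset.mul_sum, Finset.mul_sum, ← Finset.sum_add_distrib]
            exact Finset.sum_congr rfl fun i _ => by ring
          rw [e₁, e₂]
          ring
      _ = ∑ i, ∑ j, (2 * (p i - q j) * (x i j * star (y i j)).re
            - ((1 - s) * q j + s * p i) * Complex.normSq (x i j)) := by
          simp only [Finset.mul_sum, ← Finset.sum_sub_distrib, ← Finset.sum_add_distrib]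
          rw [Finset.sum_comm (s := Finset.univ (α := J)), ← Finset.sum_sub_distrib]
          refine Finset.sum_congr rfl fun i _ => ?_
          rw [← Finset.sum_sub_distrib]
          exact Finset.sum_congr rfl fun j _ => by ring
      _ ≤ _ := by
          refine Finset.sum_le_sum fun i _ => Finset.sum_le_sum fun j _ =>
            two_mul_re_sub_le _ _ ?_ ?_
          · have := mul_nonneg hs0.le (hp i)
            have := mul_nonneg (sub_nonneg.mpr hs1.le) (hq j)
            linarith
          · intro h
            have := mul_nonneg hs0.le (hp i)
            have := mul_nonneg (sub_nonneg.mpr hs1.le) (hq j)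
            have h1 : p i = 0 := (mul_eq_zero.mp (by linarith : s * p i = 0)).resolve_left hs0.ne'
            have h2 : q j = 0 := (mul_eq_zero.mp (by linarith : (1 - s) * q j = 0)).resolve_left
              (by linarith)
            rw [h1, h2, sub_zero]
  have opt (Δ m : ℝ) : 2 * Δ * (Δ / m) - m * (Δ / m) ^ 2 = Δ ^ 2 / m := by
    rcases eq_or_ne m 0 with rfl | hm
    · simp
    · field_simp
      ring
  have := key ((r₁ - c₁) / ((1 - s) * c₁ + s * r₁)) ((r₀ - c₀) / ((1 - s) * c₀ + s * r₀))
  rwa [opt, opt] at this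

lemma sum_normSq_sub {I : Type*} [Fintype I] {y a : I → ℂ} {u : ℝ}
    (hy : ∑ i, Complex.normSq (y i) = 1) (ha : ∑ i, Complex.normSq (a i) = u)
    (hay : ∑ i, (a i * star (y i)).re = u) : ∑ i, Complex.normSq (y i - a i) = 1 - u := by
  have h (i) : Complex.normSq (y i - a i)
      = Complex.normSq (y i) + Complex.normSq (a i) - 2 * (a i * star (y i)).re := by
    simp [Complex.normSq_apply]
    ring
  simp only [h, Finset.sum_sub_distrib, Finset.sum_add_distrib, ← Finset.mul_sum, hy, ha, hay]
  ring

lemma sum_mul_eq_zero_of_supp {I J : Type*} [Fintype I] [Fintype J] (y a : I → J → ℂ)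
    {u : I → ℝ} {v : J → ℝ} (ha' : ∀ j, ∑ i, Complex.normSq (a i j) = v j)
    (hay : ∀ i, ∑ j, (a i j * star (y i j)).re = u i) {p : I → ℝ} {q : J → ℝ}
    (hq : ∀ j, 0 ≤ q j) (hsupp : ∀ i j, q j = 0 → p i = 0 ∨ y i j = 0)
    (h : ∑ j, q j * v j = 0) : ∑ i, p i * u i = 0 := by
  have hv (j) : 0 ≤ v j := ha' j ▸ Finset.sum_nonneg fun i _ => Complex.normSq_nonneg _
  rw [Finset.sum_eq_zero_iff_of_nonneg fun j _ => mul_nonneg (hq j) (hv j)] at h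
  refine Finset.sum_eq_zero fun i _ => mul_eq_zero.mpr (or_iff_not_imp_left.mpr fun hpi => ?_)
  rw [← hay i]
  refine Finset.sum_eq_zero fun j _ => ?_
  rcases mul_eq_zero.mp (h j (Finset.mem_univ j)) with hj | hj
  · simp [(hsupp i j hj).resolve_left hpi]
  · rw [← ha' j, Finset.sum_eq_zero_iff_of_nonneg fun i _ => Complex.normSq_nonneg _] at hj
    simp [Complex.normSq_eq_zero.mp (hj i (Finset.mem_univ i))]

/-- Monotonicity of the relative entropy of two spectral decompositions, with overlaps `y`, under
a two-outcome projective measurement whose amplitudes are `a`. -/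
lemma binary_relEntropy_le {I J : Type*} [Fintype I] [Fintype J] (y a : I → J → ℂ)
    (u : I → ℝ) (v : J → ℝ)
    (hy : ∀ i, ∑ j, Complex.normSq (y i j) = 1) (hy' : ∀ j, ∑ i, Complex.normSq (y i j) = 1)
    (ha : ∀ i, ∑ j, Complex.normSq (a i j) = u i) (ha' : ∀ j, ∑ i, Complex.normSq (a i j) = v j)
    (hay : ∀ i, ∑ j, (a i j * star (y i j)).re = u i)
    (hay' : ∀ j, ∑ i, (a i j * star (y i j)).re = v j)
    {p : I → ℝ} {q : J → ℝ} (hp : ∀ i, 0 ≤ p i) (hq : ∀ j, 0 ≤ q j)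
    (hsupp : ∀ i j, q j = 0 → p i = 0 ∨ y i j = 0) {r₁ r₀ c₁ c₀ : ℝ}
    (hr₁ : ∑ i, p i * u i = r₁) (hr₀ : ∑ i, p i * (1 - u i) = r₀)
    (hc₁ : ∑ j, q j * v j = c₁) (hc₀ : ∑ j, q j * (1 - v j) = c₀) :
    r₁ * Real.log r₁ - r₁ * Real.log c₁ + (r₀ * Real.log r₀ - r₀ * Real.log c₀)
      ≤ ∑ i, ∑ j, Complex.normSq (y i j) * (p i * Real.log (p i) - p i * Real.log (q j)) := by
  have hb (i) := sum_normSq_sub (hy i) (ha i) (hay i)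
  have hb' (j) := sum_normSq_sub (hy' j) (ha' j) (hay' j)
  have hby (i) : ∑ j, ((y i j - a i j) * star (y i j)).re = 1 - u i := by
    rw [← hy i, ← hay i, ← Finset.sum_sub_distrib]
    refine Finset.sum_congr rfl fun j _ => ?_
    simp [Complex.normSq_apply]
    ring
  have hu (i) : 0 ≤ u i := ha i ▸ Finset.sum_nonneg fun j _ => Complex.normSq_nonneg _
  have hu' (i) : 0 ≤ 1 - u i := hb i ▸ Finset.sum_nonneg fun j _ => Complex.normSq_nonneg _
  have hv (j) : 0 ≤ v j := ha' j ▸ Finset.sum_nonneg fun i _ => Complex.normSq_nonneg _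
  have hv' (j) : 0 ≤ 1 - v j := hb' j ▸ Finset.sum_nonneg fun i _ => Complex.normSq_nonneg _
  have hr₁_nonneg : 0 ≤ r₁ := hr₁ ▸ Finset.sum_nonneg fun i _ => mul_nonneg (hp i) (hu i)
  have hr₀_nonneg : 0 ≤ r₀ := hr₀ ▸ Finset.sum_nonneg fun i _ => mul_nonneg (hp i) (hu' i)
  have hc₁_nonneg : 0 ≤ c₁ := hc₁ ▸ Finset.sum_nonneg fun j _ => mul_nonneg (hq j) (hv j)
  have hc₀_nonneg : 0 ≤ c₀ := hc₀ ▸ Finset.sum_nonneg fun j _ => mul_nonneg (hq j) (hv' j)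
  have h₁ : c₁ = 0 → r₁ = 0 := fun h =>
    hr₁ ▸ sum_mul_eq_zero_of_supp y a ha' hay hq hsupp (hc₁.trans h)
  have h₀ : c₀ = 0 → r₀ = 0 := fun h =>
    hr₀ ▸ sum_mul_eq_zero_of_supp y (fun i j => y i j - a i j) hb' hby hq hsupp (hc₀.trans h)
  let G : ℝ → ℝ := fun s => ∑ i, ∑ j, Complex.normSq (y i j) * segLog (p i) (q j) s
    - (segLog r₁ c₁ s + segLog r₀ c₀ s)
  have hcont : ContinuousOn G (Set.Icc 0 1) := by
    refine ContinuousOn.sub (continuousOn_finsetSum _ fun i _ => continuousOn_finsetSum _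
      fun j _ => ?_) ((continuousOn_segLog hr₁_nonneg hc₁_nonneg h₁).add
        (continuousOn_segLog hr₀_nonneg hc₀_nonneg h₀))
    rcases eq_or_ne (y i j) 0 with h | h
    · simp only [h, map_zero, zero_mul]
      exact continuousOn_const
    · exact continuousOn_const.mul (continuousOn_segLog (hp i) (hq j)
        fun hj => (hsupp i j hj).resolve_right h)
  have hderiv : ∀ s ∈ interior (Set.Icc (0 : ℝ) 1), HasDerivWithinAt G
      (∑ i, ∑ j, Complex.normSq (y i j) *
          ((1 - s) * ((p i - q j) ^ 2 / ((1 - s) * q j + s * p i)))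
        - ((1 - s) * ((r₁ - c₁) ^ 2 / ((1 - s) * c₁ + s * r₁))
          + (1 - s) * ((r₀ - c₀) ^ 2 / ((1 - s) * c₀ + s * r₀)))) (interior (Set.Icc 0 1)) s := by
    intro s hs
    rw [interior_Icc] at hs
    exact ((HasDerivAt.fun_sum fun i _ => HasDerivAt.fun_sum fun j _ =>
      (hasDerivAt_segLog (hp i) (hq j) hs.1 hs.2).const_mul _).sub
        ((hasDerivAt_segLog hr₁_nonneg hc₁_nonneg hs.1 hs.2).add
          (hasDerivAt_segLog hr₀_nonneg hc₀_nonneg hs.1 hs.2))).hasDerivWithinAt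
  have hmono : MonotoneOn G (Set.Icc 0 1) := by
    refine monotoneOn_of_hasDerivWithinAt_nonneg (convex_Icc 0 1) hcont hderiv fun s hs => ?_
    rw [interior_Icc] at hs
    have h := sq_div_add_sq_div_le_sum y a u v hy hy' ha ha' hay hay' hp hq hs.1 hs.2
      hr₁ hr₀ hc₁ hc₀
    have h := mul_le_mul_of_nonneg_left h (sub_nonneg.mpr hs.2.le)
    simp only [mul_left_comm _ (1 - s), ← Finset.mul_sum]
    linarith
  have h01 := hmono (Set.left_mem_Icc.mpr zero_le_one) (Set.right_mem_Icc.mpr zero_le_one)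
    zero_le_one
  have hdiff : G 1 - G 0 = ∑ i, ∑ j, Complex.normSq (y i j) *
        (p i * Real.log (p i) - p i * Real.log (q j) - p i + q j)
      - ((r₁ * Real.log r₁ - r₁ * Real.log c₁ - r₁ + c₁)
        + (r₀ * Real.log r₀ - r₀ * Real.log c₀ - r₀ + c₀)) := by
    simp only [← segLog_one_sub_zero, mul_sub, Finset.sum_sub_distrib, G]
    ring
  have hpsum : ∑ i, ∑ j, Complex.normSq (y i j) * p i = r₁ + r₀ := by
    simp only [← Finset.sum_mul, hy, ← hr₁, ← hr₀, ← Finset.sum_add_distrib]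
    exact Finset.sum_congr rfl fun i _ => by ring
  have hqsum : ∑ i, ∑ j, Complex.normSq (y i j) * q j = c₁ + c₀ := by
    rw [Finset.sum_comm]
    simp only [← Finset.sum_mul, hy', ← hc₁, ← hc₀, ← Finset.sum_add_distrib]
    exact Finset.sum_congr rfl fun i _ => by ring
  have hsplit : ∑ i, ∑ j, Complex.normSq (y i j) *
        (p i * Real.log (p i) - p i * Real.log (q j) - p i + q j)
      = ∑ i, ∑ j, Complex.normSq (y i j) * (p i * Real.log (p i) - p i * Real.log (q j))
        - (r₁ + r₀) + (c₁ + c₀) := by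
    rw [← hpsum, ← hqsum]
    simp only [← Finset.sum_sub_distrib, ← Finset.sum_add_distrib]
    exact Finset.sum_congr rfl fun i _ => Finset.sum_congr rfl fun j _ => by ring
  linarith

lemma sum_re_mul_star_row {m n : Type*} [Fintype n] (A B : Matrix m n ℂ) (i : m) :
    ∑ j, (A i j * star (B i j)).re = ((A * Bᴴ) i i).re := by
  simp [Matrix.mul_apply, Complex.re_sum]

lemma sum_re_mul_star_col {m n : Type*} [Fintype m] (A B : Matrix m n ℂ) (j : n) :
    ∑ i, (A i j * star (B i j)).re = ((Bᴴ * A) j j).re := by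
  simp only [Matrix.mul_apply, Complex.re_sum, Matrix.conjTranspose_apply, mul_comm]

lemma normSq_eq_re_mul_star (z : ℂ) : Complex.normSq z = (z * star z).re := by
  simp [Complex.mul_conj]

lemma sum_mul_normSq_col {m n : Type*} [Fintype m] [DecidableEq m] (p : m → ℝ)
    (Y : Matrix m n ℂ) (j : n) :
    ∑ i, p i * Complex.normSq (Y i j)
      = ((Yᴴ * diagonal (fun i => (p i : ℂ)) * Y) j j).re := by
  rw [Matrix.mul_assoc, Matrix.mul_apply, Complex.re_sum]
  refine Finset.sum_congr rfl fun i _ => ?_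
  rw [Matrix.diagonal_mul, Matrix.conjTranspose_apply]
  simp [Complex.normSq_apply]
  ring

lemma sum_mul_diag_eq_trace {n : Type*} [Fintype n] [DecidableEq n] (p : n → ℝ)
    (U P : Matrix n n ℂ) :
    ∑ i, p i * ((Uᴴ * P * U) i i).re
      = (P * (U * diagonal (fun i => (p i : ℂ)) * Uᴴ)).trace.re := by
  rw [← Matrix.mul_assoc, Matrix.trace_mul_comm, ← Matrix.mul_assoc, ← Matrix.mul_assoc,
    Matrix.trace, Complex.re_sum]
  refine Finset.sum_congr rfl fun i _ => ?_
  rw [Matrix.diag_apply, Matrix.mul_diagonal, Complex.re_mul_ofReal, mul_comm]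

/-- The relative entropy of `U diag(p) Uᴴ` and `W diag(q) Wᴴ` dominates that of the outcomes of
the projective measurement `{P, 1 - P}`. -/
lemma binary_relEntropy_le_of_projection {n : Type*} [Fintype n] [DecidableEq n]
    {U W P ρ : Matrix n n ℂ} (hU : U * Uᴴ = 1) (hW : W * Wᴴ = 1) (hP : Pᴴ = P) (hPP : P * P = P)
    {p q : n → ℝ} (hp : ∀ i, 0 ≤ p i) (hq : ∀ i, 0 ≤ q i)
    (hρ : ρ = U * diagonal (fun i => (p i : ℂ)) * Uᴴ)
    (hsupp : ∀ j, q j = 0 → ((Wᴴ * ρ * W) j j).re = 0)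
    {r₁ c₁ : ℝ} (hr₁ : (P * ρ).trace.re = r₁)
    (hc₁ : (P * (W * diagonal (fun i => (q i : ℂ)) * Wᴴ)).trace.re = c₁) :
    r₁ * Real.log r₁ - r₁ * Real.log c₁ + ((∑ i, p i - r₁) * Real.log (∑ i, p i - r₁)
        - (∑ i, p i - r₁) * Real.log (∑ i, q i - c₁))
      ≤ ∑ i, p i * Real.log (p i) - ∑ j, ((Wᴴ * ρ * W) j j).re * Real.log (q j) := by
  have hU' : Uᴴ * U = 1 := mul_eq_one_comm.mp hU
  have hW' : Wᴴ * W = 1 := mul_eq_one_comm.mp hW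
  let Y := Uᴴ * W
  let A := Uᴴ * P * W
  have hYY : Y * Yᴴ = 1 := by
    simp only [Y, conjTranspose_mul, conjTranspose_conjTranspose]
    rw [Matrix.mul_assoc, ← Matrix.mul_assoc W, hW, Matrix.one_mul, hU']
  have hAA : A * Aᴴ = Uᴴ * P * U := by
    simp only [A, conjTranspose_mul, conjTranspose_conjTranspose, hP]
    calc _ = Uᴴ * P * (W * Wᴴ) * P * U := by simp only [Matrix.mul_assoc]
      _ = Uᴴ * (P * P) * U := by simp only [hW, Matrix.mul_one, Matrix.mul_assoc]
      _ = _ := by rw [hPP]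
  have hAY : A * Yᴴ = Uᴴ * P * U := by
    simp only [A, Y, conjTranspose_mul, conjTranspose_conjTranspose]
    calc _ = Uᴴ * P * (W * Wᴴ) * U := by simp only [Matrix.mul_assoc]
      _ = _ := by simp only [hW, Matrix.mul_one]
  have hAA' : Aᴴ * A = Wᴴ * P * W := by
    simp only [A, conjTranspose_mul, conjTranspose_conjTranspose, hP]
    calc _ = Wᴴ * P * (U * Uᴴ) * P * W := by simp only [Matrix.mul_assoc]
      _ = Wᴴ * (P * P) * W := by simp only [hU, Matrix.mul_one, Matrix.mul_assoc]
      _ = _ := by rw [hPP]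
  have hYA : Yᴴ * A = Wᴴ * P * W := by
    simp only [A, Y, conjTranspose_mul, conjTranspose_conjTranspose]
    calc _ = Wᴴ * (U * Uᴴ) * P * W := by simp only [Matrix.mul_assoc]
      _ = _ := by simp only [hU, Matrix.mul_one]
  have hρW (j) : ∑ i, p i * Complex.normSq (Y i j) = ((Wᴴ * ρ * W) j j).re := by
    rw [sum_mul_normSq_col, hρ]
    simp only [Y, conjTranspose_mul, conjTranspose_conjTranspose, Matrix.mul_assoc]
  have hy (i) : ∑ j, Complex.normSq (Y i j) = 1 := by
    simp only [normSq_eq_re_mul_star, sum_re_mul_star_row, hYY]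
    simp
  have hy' (j) : ∑ i, Complex.normSq (Y i j) = 1 := by
    simp only [normSq_eq_re_mul_star, sum_re_mul_star_col, mul_eq_one_comm.mp hYY]
    simp
  have hrow : ∑ i, p i * ((Uᴴ * P * U) i i).re = r₁ := by rw [sum_mul_diag_eq_trace, ← hρ, hr₁]
  have hcol : ∑ i, q i * ((Wᴴ * P * W) i i).re = c₁ := by rw [sum_mul_diag_eq_trace, hc₁]
  refine (binary_relEntropy_le (r₀ := ∑ i, p i - r₁) (c₀ := ∑ i, q i - c₁) Y A
    (fun i => ((Uᴴ * P * U) i i).re) (fun j => ((Wᴴ * P * W) j j).re)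
    hy hy' ?_ ?_ ?_ ?_ hp hq ?_ hrow ?_ hcol ?_).trans_eq ?_
  · intro i
    simp only [normSq_eq_re_mul_star, sum_re_mul_star_row, hAA]
  · intro j
    simp only [normSq_eq_re_mul_star, sum_re_mul_star_col, hAA']
  · intro i
    rw [sum_re_mul_star_row, hAY]
  · intro j
    rw [sum_re_mul_star_col, hYA]
  · intro i j hj
    have h := (hρW j).trans (hsupp j hj)
    rw [Finset.sum_eq_zero_iff_of_nonneg fun i _ =>
      mul_nonneg (hp i) (Complex.normSq_nonneg _)] at h
    simpa using h i (Finset.mem_univ i)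
  · simp only [mul_sub, mul_one, Finset.sum_sub_distrib, hrow]
  · simp only [mul_sub, mul_one, Finset.sum_sub_distrib, hcol]
  · simp only [mul_sub, Finset.sum_sub_distrib, ← Finset.sum_mul, hy, one_mul]
    congr 1
    rw [Finset.sum_comm]
    refine Finset.sum_congr rfl fun j _ => ?_
    rw [← hρW j, Finset.sum_mul]
    exact Finset.sum_congr rfl fun i _ => by ring

lemma Matrix.IsHermitian.eq_mul_diagonal_mul {n : Type*} [Fintype n] [DecidableEq n]
    {A : Matrix n n ℂ} (hA : A.IsHermitian) :
    A = (hA.eigenvectorUnitary : Matrix n n ℂ) * diagonal (fun i => (hA.eigenvalues i : ℂ))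
      * (hA.eigenvectorUnitary : Matrix n n ℂ)ᴴ := by
  conv_lhs => rw [hA.spectral_theorem, Unitary.conjStarAlgAut_apply]
  rfl

lemma Matrix.IsHermitian.eigenvectorUnitary_mul_conjTranspose {n : Type*} [Fintype n]
    [DecidableEq n] {A : Matrix n n ℂ} (hA : A.IsHermitian) :
    (hA.eigenvectorUnitary : Matrix n n ℂ) * (hA.eigenvectorUnitary : Matrix n n ℂ)ᴴ = 1 :=
  Unitary.coe_mul_star_self hA.eigenvectorUnitary

lemma Matrix.IsHermitian.conjTranspose_mul_mul_eq_diagonal {n : Type*} [Fintype n] [DecidableEq n]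
    {A : Matrix n n ℂ} (hA : A.IsHermitian) :
    (hA.eigenvectorUnitary : Matrix n n ℂ)ᴴ * A * (hA.eigenvectorUnitary : Matrix n n ℂ)
      = diagonal (fun i => (hA.eigenvalues i : ℂ)) := by
  have hV := mul_eq_one_comm.mp hA.eigenvectorUnitary_mul_conjTranspose
  have h := congrArg (fun B => (hA.eigenvectorUnitary : Matrix n n ℂ)ᴴ * B
    * (hA.eigenvectorUnitary : Matrix n n ℂ)) hA.eq_mul_diagonal_mul
  refine h.trans ?_
  simp only [Matrix.mul_assoc, hV, Matrix.mul_one]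
  rw [← Matrix.mul_assoc, hV, Matrix.one_mul]

/-- Variational lower bound on the trace norm: `Re Tr(WA) ≤ ‖A‖₁` for `W` unitary. -/
lemma re_trace_mul_le_traceNorm {n : Type*} [Fintype n] [DecidableEq n] {W : Matrix n n ℂ}
    (hW : W * Wᴴ = 1) (A : Matrix n n ℂ) : (W * A).trace.re ≤ traceNorm A := by
  have hH := (Matrix.posSemidef_conjTranspose_mul_self A).1
  set V : Matrix n n ℂ := (hH.eigenvectorUnitary : Matrix n n ℂ) with hVdef
  have hV : V * Vᴴ = 1 := hH.eigenvectorUnitary_mul_conjTranspose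
  let X := Wᴴ * V
  let Z := A * V
  have hX : Xᴴ * X = 1 := by
    simp only [X, conjTranspose_mul, conjTranspose_conjTranspose]
    rw [Matrix.mul_assoc, ← Matrix.mul_assoc W, hW, Matrix.one_mul, mul_eq_one_comm.mp hV]
  have hZ : Zᴴ * Z = diagonal (fun i => (hH.eigenvalues i : ℂ)) := by
    rw [← hH.conjTranspose_mul_mul_eq_diagonal]
    simp only [Z, conjTranspose_mul, Matrix.mul_assoc, hVdef]
  have htr : (W * A).trace = (Xᴴ * Z).trace := by
    simp only [X, Z, conjTranspose_mul, conjTranspose_conjTranspose]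
    rw [← Matrix.mul_assoc, Matrix.trace_mul_comm _ V, ← Matrix.mul_assoc, ← Matrix.mul_assoc, hV,
      Matrix.one_mul]
  rw [htr, Matrix.trace, Complex.re_sum, traceNorm]
  refine Finset.sum_le_sum fun i _ => ?_
  rw [Matrix.diag_apply, ← sum_re_mul_star_col]
  calc ∑ k, (Z k i * star (X k i)).re ≤ ∑ k, ‖Z k i‖ * ‖X k i‖ :=
        Finset.sum_le_sum fun k _ => (Complex.re_le_norm _).trans_eq (by simp)
    _ ≤ √(∑ k, ‖Z k i‖ ^ 2) * √(∑ k, ‖X k i‖ ^ 2) := Real.sum_mul_le_sqrt_mul_sqrt _ _ _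
    _ = √(hH.eigenvalues i) := by
        simp only [← Complex.normSq_eq_norm_sq, normSq_eq_re_mul_star, sum_re_mul_star_col, hX, hZ]
        simp

lemma ptraceA_eq_sum_submatrix {a b : Type*} [Fintype a] [Fintype b]
    (ρ : Matrix (a × b) (a × b) ℂ) :
    ptraceA ρ = ∑ k, ρ.submatrix (Prod.mk k) (Prod.mk k) := by
  ext i j
  simp [ptraceA, Matrix.sum_apply]

lemma posSemidef_ptraceA {a b : Type*} [Fintype a] [Fintype b]
    {ρ : Matrix (a × b) (a × b) ℂ} (hρ : ρ.PosSemidef) : (ptraceA ρ).PosSemidef := by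
  rw [ptraceA_eq_sum_submatrix]
  exact Matrix.posSemidef_sum _ fun k _ => hρ.submatrix _

lemma trace_ptraceA {a b : Type*} [Fintype a] [Fintype b]
    (ρ : Matrix (a × b) (a × b) ℂ) : (ptraceA ρ).trace = ρ.trace := by
  simp only [Matrix.trace, Matrix.diag_apply, ptraceA, Fintype.sum_prod_type]
  exact Finset.sum_comm

open scoped Kronecker in
lemma ptraceA_conj_one_kronecker {a b : Type*} [Fintype a] [Fintype b] [DecidableEq a]
    (ρ : Matrix (a × b) (a × b) ℂ) (V : Matrix b b ℂ) :
    ptraceA (((1 : Matrix a a ℂ) ⊗ₖ V)ᴴ * ρ * ((1 : Matrix a a ℂ) ⊗ₖ V))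
      = Vᴴ * ptraceA ρ * V := by
  have h (k : a) : (((1 : Matrix a a ℂ) ⊗ₖ V)ᴴ * ρ * ((1 : Matrix a a ℂ) ⊗ₖ V)).submatrix
      (Prod.mk k) (Prod.mk k) = Vᴴ * ρ.submatrix (Prod.mk k) (Prod.mk k) * V := by
    ext i j
    simp [Matrix.mul_apply, Fintype.sum_prod_type, Matrix.conjTranspose_apply,
      Matrix.kroneckerMap_apply, Matrix.one_apply, apply_ite]
  simp only [ptraceA_eq_sum_submatrix, h, Finset.mul_sum, Finset.sum_mul]

lemma conjTranspose_maxEntState (d : ℕ) : (maxEntState d)ᴴ = maxEntState d := by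
  ext p q
  simp only [maxEntState, Matrix.conjTranspose_apply, and_comm]
  split_ifs <;> simp

lemma maxEntState_mul_self {d : ℕ} (hd : d ≠ 0) :
    maxEntState d * maxEntState d = maxEntState d := by
  ext p q
  have hd' : (d : ℂ) ≠ 0 := Nat.cast_ne_zero.mpr hd
  by_cases hp : p.1 = p.2 <;> by_cases hq : q.1 = q.2 <;>
    simp [maxEntState, Matrix.mul_apply, Fintype.sum_prod_type, hp, hq, hd']

lemma trace_maxEntState {d : ℕ} (hd : d ≠ 0) : (maxEntState d).trace = 1 := by
  have hd' : (d : ℂ) ≠ 0 := Nat.cast_ne_zero.mpr hd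
  simp [maxEntState, Matrix.trace, Fintype.sum_prod_type, hd']

open scoped Kronecker in
lemma trace_maxEntState_mul_one_kronecker (d : ℕ) (B : Matrix (Fin d) (Fin d) ℂ) :
    (maxEntState d * ((1 : Matrix (Fin d) (Fin d) ℂ) ⊗ₖ B)).trace = (d : ℂ)⁻¹ * B.trace := by
  rw [Matrix.trace_mul_comm]
  simp [maxEntState, Matrix.trace, Matrix.mul_apply, Fintype.sum_prod_type, Matrix.one_apply,
    ite_and, Finset.mul_sum, mul_comm]

/-- Conditional quantum Fano inequality, in nats. -/
lemma fano_conditional {d : ℕ} (hd : d ≠ 0)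
    {ρ : Matrix (Fin d × Fin d) (Fin d × Fin d) ℂ} (hρ : IsDensity ρ) {F : ℝ}
    (hF : (maxEntState d * ρ).trace.re = F) :
    F * Real.log F - F * Real.log (d : ℝ)⁻¹
        + ((1 - F) * Real.log (1 - F) - (1 - F) * Real.log (d - (d : ℝ)⁻¹))
      ≤ cohInfo ρ * Real.log 2 := by
  have hρH := hρ.1.1
  have hB := posSemidef_ptraceA hρ.1
  have hBtr : (ptraceA ρ).trace = 1 := (trace_ptraceA ρ).trans hρ.2
  let V : Matrix (Fin d) (Fin d) ℂ := (hB.1.eigenvectorUnitary : Matrix (Fin d) (Fin d) ℂ)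
  have hV : V * Vᴴ = 1 := hB.1.eigenvectorUnitary_mul_conjTranspose
  let W := Matrix.kroneckerMap (· * ·) (1 : Matrix (Fin d) (Fin d) ℂ) V
  have hW : W * Wᴴ = 1 := by
    simp only [W, Matrix.conjTranspose_kronecker, ← Matrix.mul_kronecker_mul, hV]
    simp
  let b := hB.1.eigenvalues
  have hdiag : diagonal (fun x : Fin d × Fin d => (b x.2 : ℂ))
      = Matrix.kroneckerMap (· * ·) (1 : Matrix (Fin d) (Fin d) ℂ)
        (diagonal fun j => (b j : ℂ)) := by
    rw [← Matrix.diagonal_one, Matrix.diagonal_kronecker_diagonal]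
    simp
  have hσ : W * diagonal (fun x : Fin d × Fin d => (b x.2 : ℂ)) * Wᴴ
      = Matrix.kroneckerMap (· * ·) (1 : Matrix (Fin d) (Fin d) ℂ) (ptraceA ρ) := by
    rw [hdiag]
    simp only [W, Matrix.conjTranspose_kronecker, ← Matrix.mul_kronecker_mul]
    rw [hB.1.eq_mul_diagonal_mul]
    simp [V, b]
  have hsum (j) : ∑ k, ((Wᴴ * ρ * W) (k, j) (k, j)).re = b j := by
    have h := congrFun (congrFun (ptraceA_conj_one_kronecker ρ V) j) j
    rw [hB.1.conjTranspose_mul_mul_eq_diagonal, Matrix.diagonal_apply_eq] at h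
    simpa [ptraceA] using congrArg Complex.re h
  have hnonneg (x) : 0 ≤ ((Wᴴ * ρ * W) x x).re :=
    (Complex.nonneg_iff.mp (hρ.1.conjTranspose_mul_mul_same W).diag_nonneg).1
  have hp : ∑ i, hρH.eigenvalues i = 1 := by
    simpa using congrArg Complex.re (hρH.trace_eq_sum_eigenvalues.symm.trans hρ.2)
  have hb : ∑ x : Fin d × Fin d, b x.2 = d := by
    have h : ∑ j, b j = 1 := by
      simpa using congrArg Complex.re (hB.1.trace_eq_sum_eigenvalues.symm.trans hBtr)
    simp [Fintype.sum_prod_type, h]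
  have h := binary_relEntropy_le_of_projection (q := fun x : Fin d × Fin d => b x.2)
    (c₁ := (d : ℝ)⁻¹) hρH.eigenvectorUnitary_mul_conjTranspose hW (conjTranspose_maxEntState d)
    (maxEntState_mul_self hd) hρ.1.eigenvalues_nonneg (fun x => hB.eigenvalues_nonneg x.2)
    hρH.eq_mul_diagonal_mul ?_ hF ?_
  · rw [hp, hb] at h
    refine h.trans_eq ?_
    have hlog : Real.log 2 ≠ 0 := (Real.log_pos one_lt_two).ne'
    rw [cohInfo, vNE, vNE, dif_pos hB.1, dif_pos hρH, ← sub_div, div_mul_cancel₀ _ hlog]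
    simp only [Real.negMulLog, Fintype.sum_prod_type_right, ← Finset.sum_mul, hsum, neg_mul,
      Finset.sum_neg_distrib, b]
    ring
  · rintro ⟨k, j⟩ hj
    rw [← hsum j, Finset.sum_eq_zero_iff_of_nonneg fun k _ => hnonneg _] at hj
    exact hj k (Finset.mem_univ k)
  · rw [hσ, trace_maxEntState_mul_one_kronecker, hBtr, mul_one]
    simp

lemma one_sub_fidelity_le_traceNorm {d : ℕ} (hd : d ≠ 0)
    {ρ : Matrix (Fin d × Fin d) (Fin d × Fin d) ℂ} (hρ : ρ.trace = 1) :
    1 - (maxEntState d * ρ).trace.re ≤ 1 / 2 * traceNorm (ρ - maxEntState d) := by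
  have hPP := maxEntState_mul_self hd
  have hW : (1 - (2 : ℂ) • maxEntState d) * (1 - (2 : ℂ) • maxEntState d)ᴴ = 1 := by
    simp only [conjTranspose_sub, conjTranspose_one, conjTranspose_smul,
      conjTranspose_maxEntState, Matrix.sub_mul, Matrix.mul_sub, Matrix.smul_mul, Matrix.mul_smul,
      hPP, Matrix.one_mul, Matrix.mul_one, star_ofNat]
    module
  have h := re_trace_mul_le_traceNorm hW (ρ - maxEntState d)
  have htr : ((1 - (2 : ℂ) • maxEntState d) * (ρ - maxEntState d)).trace
      = 2 - 2 * (maxEntState d * ρ).trace := by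
    simp only [Matrix.sub_mul, Matrix.mul_sub, Matrix.one_mul, Matrix.smul_mul, hPP,
      Matrix.trace_sub, Matrix.trace_smul, hρ, trace_maxEntState hd, smul_eq_mul]
    ring
  rw [htr] at h
  simp at h
  linarith

lemma fidelity_mem_Icc {d : ℕ} (hd : d ≠ 0)
    {ρ : Matrix (Fin d × Fin d) (Fin d × Fin d) ℂ} (hρ : IsDensity ρ) :
    0 ≤ (maxEntState d * ρ).trace.re ∧ (maxEntState d * ρ).trace.re ≤ 1 := by
  have key {P : Matrix (Fin d × Fin d) (Fin d × Fin d) ℂ} (hP : Pᴴ = P) (hPP : P * P = P) :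
      0 ≤ (P * ρ).trace.re := by
    have h := (hρ.1.mul_mul_conjTranspose_same P).trace_nonneg
    rw [hP, Matrix.trace_mul_comm, ← Matrix.mul_assoc, hPP] at h
    exact (Complex.nonneg_iff.mp h).1
  have hPP := maxEntState_mul_self hd
  refine ⟨key (conjTranspose_maxEntState d) hPP, ?_⟩
  have h := key (P := 1 - maxEntState d) (by simp [conjTranspose_maxEntState])
    (by simp [Matrix.sub_mul, Matrix.mul_sub, hPP])
  simpa [Matrix.sub_mul, Matrix.trace_sub, hρ.2] using h

lemma monotoneOn_one_add_mul_log_sub :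
    MonotoneOn (fun x : ℝ => (1 + x) * Real.log (1 + x) - x * Real.log x) (Set.Ici 0) := by
  refine monotoneOn_of_hasDerivWithinAt_nonneg
    (f' := fun x => Real.log (1 + x) - Real.log x) (convex_Ici 0) ?_ ?_ ?_
  · exact ((Real.continuous_mul_log.comp (by fun_prop : Continuous fun x : ℝ => 1 + x)).sub
      Real.continuous_mul_log).continuousOn
  · intro x hx
    rw [interior_Ici] at hx
    have hx : (0 : ℝ) < x := hx
    have h := ((Real.hasDerivAt_mul_log (by linarith : (1 + x) ≠ 0)).comp x
      ((hasDerivAt_id x).const_add 1)).sub (Real.hasDerivAt_mul_log hx.ne')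
    refine (h.congr_deriv ?_).hasDerivWithinAt
    ring
  · intro x hx
    rw [interior_Ici] at hx
    exact sub_nonneg.mpr (Real.log_le_log hx (by linarith))

lemma one_add_mul_binEnt {α : ℝ} (hα : 0 ≤ α) :
    (1 + α) * binEnt (α / (1 + α)) * Real.log 2
      = (1 + α) * Real.log (1 + α) - α * Real.log α := by
  have hlog : Real.log 2 ≠ 0 := (Real.log_pos one_lt_two).ne'
  rcases hα.eq_or_lt with rfl | hα
  · simp [binEnt]
  have h1 : (1 + α) ≠ 0 := by linarith
  have h2 : 1 - α / (1 + α) = 1 / (1 + α) := by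
    field_simp
    ring
  rw [binEnt, h2, Real.negMulLog, Real.negMulLog, Real.log_div hα.ne' h1,
    Real.log_div one_ne_zero h1, Real.log_one]
  field_simp
  ring

lemma neg_mul_log_one_sub_le {ε : ℝ} (h0 : 0 ≤ ε) (h1 : ε ≤ 1) :
    -((1 - ε) * Real.log (1 - ε)) ≤ (1 + ε) * Real.log (1 + ε) := by
  have h2 : ε ≤ (1 + ε) * Real.log (1 + ε) := by
    have h := Real.one_sub_inv_le_log_of_pos (by linarith : 0 < 1 + ε)
    have h := mul_le_mul_of_nonneg_left h (by linarith : 0 ≤ 1 + ε)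
    rwa [mul_sub, mul_inv_cancel₀ (by linarith), mul_one, add_sub_cancel_left] at h
  rcases h1.eq_or_lt with rfl | h1
  · norm_num at h2 ⊢
    linarith
  · have h := Real.one_sub_inv_le_log_of_pos (by linarith : 0 < 1 - ε)
    have h := mul_le_mul_of_nonneg_left h (by linarith : 0 ≤ 1 - ε)
    rw [mul_sub, mul_inv_cancel₀ (by linarith), mul_one] at h
    linarith

/-- Entanglement-generation converse step: if `ρ_{K M̂}` is a density operator
on systems of dimension `2^{nQ}` each and `(1/2)‖ρ_{K M̂} - Φ_{KM}‖₁ ≤ α`, then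
`I(K⟩M̂)_ρ ≥ nQ - f(α, nQ)` with `f(α,t) = 2αt + (1+α) h₂(α/(1+α))`
(Alicki–Fannes–Winter bound). -/
theorem entGen_converse_AFW {t : ℕ} {α : ℝ} (hα : 0 ≤ α)
    (ρ : Matrix (Fin (2 ^ t) × Fin (2 ^ t)) (Fin (2 ^ t) × Fin (2 ^ t)) ℂ)
    (hρ : IsDensity ρ)
    (hclose : (1 / 2) * traceNorm (ρ - maxEntState (2 ^ t)) ≤ α) :
    cohInfo ρ ≥ (t : ℝ) - (2 * α * t + (1 + α) * binEnt (α / (1 + α))) := by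
  have hd : 2 ^ t ≠ 0 := by positivity
  have hlog : 0 < Real.log 2 := Real.log_pos one_lt_two
  obtain ⟨hF0, hF1⟩ := fidelity_mem_Icc hd hρ
  have hε := (one_sub_fidelity_le_traceNorm hd hρ.2).trans hclose
  have hfano := fano_conditional hd hρ rfl
  set F := (maxEntState (2 ^ t) * ρ).trace.re
  have hL : Real.log ((2 ^ t : ℕ) : ℝ) = t * Real.log 2 := by
    push_cast
    exact Real.log_pow _ _
  have hd1 : (1 : ℝ) ≤ ((2 ^ t : ℕ) : ℝ) := by exact_mod_cast Nat.one_le_two_pow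
  have hL0 : 0 ≤ t * Real.log 2 := by positivity
  have hL' : Real.log (((2 ^ t : ℕ) : ℝ) - ((2 ^ t : ℕ) : ℝ)⁻¹) ≤ t * Real.log 2 := by
    have hinv : 0 < ((2 ^ t : ℕ) : ℝ)⁻¹ := by positivity
    rcases (sub_nonneg.mpr ((inv_le_one_of_one_le₀ hd1).trans hd1)).eq_or_lt with h | h
    · rw [← h, Real.log_zero]
      exact hL0
    · rw [← hL]
      exact Real.log_le_log h (by linarith)
  have hmul := mul_le_mul_of_nonneg_left hL' (sub_nonneg.mpr hF1)
  have hmono := monotoneOn_one_add_mul_log_sub (Set.mem_Ici.mpr (sub_nonneg.mpr hF1))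
    (Set.mem_Ici.mpr hα) hε
  have hneg := neg_mul_log_one_sub_le (sub_nonneg.mpr hF1) (by linarith)
  have hmulα := mul_le_mul_of_nonneg_right hε hL0
  rw [sub_sub_cancel] at hneg
  rw [Real.log_inv, hL] at hfano
  simp only at hmono
  refine le_of_mul_le_mul_right ?_ hlog
  rw [sub_mul, add_mul, one_add_mul_binEnt hα]
  linarith

end
end
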